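/- arXiv:1701.05538 — 3 statements merged into one kernel-verified Lean document; each statement's English description precedes it below -/
import Mathlib

section
/- Let f be a holomorphic function on the open unit disc 𝔻 such that |f(z)| tends to 1 as |z| tends to 1 (i.e., for every ε > 0 there exists r < 1 such that 1 − ε < |f(z)| < 1 + ε whenever r < |z| < 1). Then f is a finite Blaschke product. -/
open Complex Metric Set

/-- The finite Blaschke product with unimodular constant `c` and zeros parameters `a k ∈ 𝔻`. -/
noncomputable def finBlaschke (n : ℕ) (c : ℂ) (a : Fin n → ℂ) : ℂ → ℂ :=
  fun z => c * ∏ k, (a k - z) / (1 - (starRingEnd ℂ) (a k) * z)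

/-- `f` is a finite Blaschke product on the set `s`. -/
def IsFiniteBlaschkeOn (f : ℂ → ℂ) (s : Set ℂ) : Prop :=
  ∃ (n : ℕ) (c : ℂ) (a : Fin n → ℂ),
    ‖c‖ = 1 ∧ (∀ k, ‖a k‖ < 1) ∧ Set.EqOn f (finBlaschke n c a) s

open Filter Topology in
/-- Holomorphic on the disc, with modulus tending to one at the boundary. -/
def FatouP (f : ℂ → ℂ) : Prop :=
  DifferentiableOn ℂ f (ball (0:ℂ) 1) ∧
    Tendsto (fun z => ‖f z‖) (comap (fun z : ℂ => ‖z‖) (𝓝[<] (1:ℝ))) (𝓝 1)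

open Filter Topology in
theorem fatou_ev {p : ℂ → Prop} :
    (∀ᶠ z in comap (fun z : ℂ => ‖z‖) (𝓝[<] (1:ℝ)), p z) ↔
      ∃ r : ℝ, r < 1 ∧ ∀ z : ℂ, r < ‖z‖ → ‖z‖ < 1 → p z := by
  rw [((nhdsLT_basis (1:ℝ)).comap (fun z : ℂ => ‖z‖)).eventually_iff]
  constructor
  · rintro ⟨r, hr, h⟩
    exact ⟨r, hr, fun z h1 h2 => h ⟨h1, h2⟩⟩
  · rintro ⟨r, hr, h⟩
    exact ⟨r, hr, fun z hz => h z hz.1 hz.2⟩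

open Filter Topology in
theorem fatou_le {f : ℂ → ℂ} (hf : FatouP f) {z : ℂ} (hz : ‖z‖ < 1) : ‖f z‖ ≤ 1 := by
  refine le_of_forall_pos_le_add fun ε hε => ?_
  obtain ⟨r, hr, h⟩ := fatou_ev.1 (hf.2.eventually (gt_mem_nhds (show (1:ℝ) < 1 + ε by linarith)))
  obtain ⟨s, hs1, hs2⟩ := exists_between (max_lt hr hz)
  have hzs : ‖z‖ < s := (le_max_right _ _).trans_lt hs1
  have hrs : r < s := (le_max_left _ _).trans_lt hs1
  have hs0 : 0 < s := (norm_nonneg z).trans_lt hzs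
  refine Complex.norm_le_of_forall_mem_frontier_norm_le (U := ball (0:ℂ) s) isBounded_ball ?_ ?_
    (subset_closure (by simpa using hzs))
  · apply DifferentiableOn.diffContOnCl
    rw [closure_ball _ hs0.ne']
    exact hf.1.mono (closedBall_subset_ball hs2)
  · intro w hw
    rw [frontier_ball _ hs0.ne'] at hw
    have : ‖w‖ = s := by simpa using hw
    exact (h w (by rw [this]; exact hrs) (by rw [this]; exact hs2)).le

theorem fatou_nozero {f : ℂ → ℂ} (hf : FatouP f) (h0 : ∀ z, ‖z‖ < 1 → f z ≠ 0) :
    ∃ c : ℂ, ‖c‖ = 1 ∧ ∀ z, ‖z‖ < 1 → f z = c := by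
  have hg : FatouP (fun z => (f z)⁻¹) := by
    refine ⟨hf.1.inv (fun z hz => h0 z (by simpa using hz)), ?_⟩
    simpa using hf.2.inv₀ one_ne_zero
  have h1 : ∀ z, ‖z‖ < 1 → ‖f z‖ = 1 := by
    intro z hz
    refine le_antisymm (fatou_le hf hz) ?_
    have h := fatou_le hg hz
    rw [norm_inv] at h
    have hp : 0 < ‖f z‖ := norm_pos_iff.2 (h0 z hz)
    exact (inv_le_one₀ hp).1 h
  refine ⟨f 0, h1 0 (by simp), fun z hz => ?_⟩
  refine Complex.eqOn_of_isPreconnected_of_isMaxOn_norm (U := ball (0:ℂ) 1) (c := 0)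
    (convex_ball _ _).isPreconnected isOpen_ball hf.1 (by simp) ?_ (by simpa using hz)
  intro w hw
  simp only [mem_ball, dist_zero_right] at hw
  simp [h1 w hw, h1 0 (by simp)]

theorem fatou_den {a z : ℂ} (ha : ‖a‖ < 1) (hz : ‖z‖ < 1) :
    1 - ‖a‖ ≤ ‖1 - (starRingEnd ℂ) a * z‖ := by
  have h := norm_sub_norm_le (1:ℂ) ((starRingEnd ℂ) a * z)
  rw [norm_mul, RCLike.norm_conj, norm_one] at h
  have := mul_le_mul_of_nonneg_left hz.le (norm_nonneg a)
  linarith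

theorem fatou_sq (a z : ℂ) : ‖1 - (starRingEnd ℂ) a * z‖ ^ 2 - ‖a - z‖ ^ 2 =
    (1 - ‖a‖ ^ 2) * (1 - ‖z‖ ^ 2) := by
  simp only [← Complex.normSq_eq_norm_sq, Complex.normSq_apply]
  simp
  ring

theorem fatou_bsq {a z : ℂ} (ha : ‖a‖ < 1) (hz : ‖z‖ < 1) :
    ‖(a - z) / (1 - (starRingEnd ℂ) a * z)‖ ^ 2 =
      1 - (1 - ‖a‖ ^ 2) * (1 - ‖z‖ ^ 2) / ‖1 - (starRingEnd ℂ) a * z‖ ^ 2 := by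
  have hd : 0 < ‖1 - (starRingEnd ℂ) a * z‖ := by linarith [fatou_den ha hz]
  rw [norm_div, div_pow, ← fatou_sq, sub_div, div_self (pow_ne_zero 2 hd.ne')]
  ring

open Filter Topology in
theorem fatou_btend {a : ℂ} (ha : ‖a‖ < 1) :
    Tendsto (fun z => ‖(a - z) / (1 - (starRingEnd ℂ) a * z)‖)
      (comap (fun z : ℂ => ‖z‖) (𝓝[<] (1:ℝ))) (𝓝 1) := by
  have hn : Tendsto (fun z : ℂ => ‖z‖) (comap (fun z : ℂ => ‖z‖) (𝓝[<] (1:ℝ))) (𝓝 1) :=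
    tendsto_comap.mono_right nhdsWithin_le_nhds
  have hlow : Tendsto (fun z : ℂ => 1 - (1 - ‖a‖ ^ 2) * (1 - ‖z‖ ^ 2) / (1 - ‖a‖) ^ 2)
      (comap (fun z : ℂ => ‖z‖) (𝓝[<] (1:ℝ))) (𝓝 1) := by
    have := (((hn.pow 2).const_sub 1).const_mul (1 - ‖a‖ ^ 2)).div_const ((1 - ‖a‖) ^ 2)
    simpa using this.const_sub 1
  have ha2 : 0 ≤ 1 - ‖a‖ ^ 2 := by nlinarith [norm_nonneg a]
  have hsq : Tendsto (fun z => ‖(a - z) / (1 - (starRingEnd ℂ) a * z)‖ ^ 2)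
      (comap (fun z : ℂ => ‖z‖) (𝓝[<] (1:ℝ))) (𝓝 1) := by
    refine tendsto_of_tendsto_of_tendsto_of_le_of_le' hlow tendsto_const_nhds ?_ ?_
    · refine fatou_ev.2 ⟨0, one_pos, fun z _ hz => ?_⟩
      have hz2 : 0 ≤ 1 - ‖z‖ ^ 2 := by nlinarith [norm_nonneg z]
      have hd := fatou_den ha hz
      have h1 : 0 < 1 - ‖a‖ := by linarith
      rw [fatou_bsq ha hz]
      gcongr
    · refine fatou_ev.2 ⟨0, one_pos, fun z _ hz => ?_⟩
      have hz2 : 0 ≤ 1 - ‖z‖ ^ 2 := by nlinarith [norm_nonneg z]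
      rw [fatou_bsq ha hz]
      have : 0 ≤ (1 - ‖a‖ ^ 2) * (1 - ‖z‖ ^ 2) / ‖1 - (starRingEnd ℂ) a * z‖ ^ 2 := by positivity
      linarith
  have h := hsq.sqrt
  rw [Real.sqrt_one] at h
  exact h.congr fun z => Real.sqrt_sq (norm_nonneg _)

open Filter Topology in
theorem fatou_divide {f : ℂ → ℂ} (hf : FatouP f) {a : ℂ} (ha : ‖a‖ < 1) (h0 : f a = 0) :
    ∃ g, FatouP g ∧ ∀ z, ‖z‖ < 1 → f z = (a - z) / (1 - (starRingEnd ℂ) a * z) * g z := by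
  have key : ∀ z, ‖z‖ < 1 → f z = (a - z) / (1 - (starRingEnd ℂ) a * z) *
      (-(dslope f a z) * (1 - (starRingEnd ℂ) a * z)) := by
    intro z hz
    have hd : 1 - (starRingEnd ℂ) a * z ≠ 0 := by
      apply norm_pos_iff.1
      linarith [fatou_den ha hz]
    have h := sub_smul_dslope f a z
    rw [h0, sub_zero, smul_eq_mul] at h
    rw [mul_comm (-(dslope f a z)), ← mul_assoc, div_mul_cancel₀ _ hd, ← h]
    ring
  refine ⟨fun z => -(dslope f a z) * (1 - (starRingEnd ℂ) a * z), ⟨?_, ?_⟩, key⟩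
  · have : DifferentiableOn ℂ (dslope f a) (ball (0:ℂ) 1) :=
      (Complex.differentiableOn_dslope (isOpen_ball.mem_nhds (by simpa using ha))).2 hf.1
    exact this.neg.mul (by fun_prop)
  · have h := hf.2.div (fatou_btend ha) one_ne_zero
    rw [div_one] at h
    refine h.congr' (fatou_ev.2 ⟨‖a‖, ha, fun z h1 h2 => ?_⟩)
    have hb : (a - z) / (1 - (starRingEnd ℂ) a * z) ≠ 0 := by
      refine div_ne_zero (fun h => ?_) (norm_pos_iff.1 (by linarith [fatou_den ha h2]))
      rw [sub_eq_zero.1 h] at h1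
      exact lt_irrefl _ h1
    have hb' := norm_pos_iff.2 hb
    simp only [Pi.div_apply]
    rw [div_eq_iff hb'.ne', mul_comm, ← norm_mul]
    exact congrArg norm (key z h2)

theorem fatou_induct {r ρ : ℝ} {z₀ : ℂ} (hz₀ : ‖z₀‖ < 1) (hρ0 : 0 < ρ)
    (hρ : ∀ a : ℂ, ‖a‖ < 1 → ‖a‖ ≤ r → ‖(a - z₀) / (1 - (starRingEnd ℂ) a * z₀)‖ ≤ ρ) (n : ℕ) :
    ∀ f : ℂ → ℂ, FatouP f → (∀ z, ‖z‖ < 1 → f z = 0 → ‖z‖ ≤ r) → ρ ^ n < ‖f z₀‖ →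
      IsFiniteBlaschkeOn f (ball (0:ℂ) 1) := by
  induction n with
  | zero =>
    intro f hf _ h
    have := fatou_le hf hz₀
    rw [pow_zero] at h
    linarith
  | succ n ih =>
    intro f hf hr h
    by_cases hz : ∀ z, ‖z‖ < 1 → f z ≠ 0
    · obtain ⟨c, hc, hfc⟩ := fatou_nozero hf hz
      refine ⟨0, c, Fin.elim0, hc, fun k => k.elim0, fun z hz => ?_⟩
      simp [finBlaschke, hfc z (by simpa using hz)]
    · push Not at hz
      obtain ⟨a, ha, h0⟩ := hz
      obtain ⟨g, hg, hfg⟩ := fatou_divide hf ha h0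
      obtain ⟨m, c, b, hc, hb, heq⟩ := ih g hg
        (fun z hz h => hr z hz (by rw [hfg z hz, h, mul_zero])) (by
          rw [hfg z₀ hz₀, norm_mul] at h
          have h2 := mul_le_mul_of_nonneg_right (hρ a ha (hr a ha h0)) (norm_nonneg (g z₀))
          rw [pow_succ'] at h
          exact lt_of_mul_lt_mul_left (h.trans_le h2) hρ0.le)
      refine ⟨m + 1, c, Fin.cons a b, hc, fun k => ?_, fun z hz => ?_⟩
      · refine Fin.cases ?_ (fun i => ?_) k
        · simpa using ha
        · simpa using hb i
      · rw [hfg z (by simpa using hz), heq hz]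
        simp only [finBlaschke, Fin.prod_univ_succ, Fin.cons_zero, Fin.cons_succ]
        ring

open Filter Topology in
/-- **Fatou's lemma on finite Blaschke products.**  If `f` is holomorphic on the open unit
disc and `|f(z)| → 1` as `|z| → 1`, then `f` is a finite Blaschke product. -/
theorem fatou_finite_blaschke (f : ℂ → ℂ)
    (hf : DifferentiableOn ℂ f (ball (0:ℂ) 1))
    (hlim : ∀ ε : ℝ, 0 < ε → ∃ r : ℝ, r < 1 ∧
      ∀ z : ℂ, r < ‖z‖ → ‖z‖ < 1 → 1 - ε < ‖f z‖ ∧ ‖f z‖ < 1 + ε) :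
    IsFiniteBlaschkeOn f (ball (0:ℂ) 1) := by
  have hP : FatouP f := by
    refine ⟨hf, Metric.tendsto_nhds.2 fun ε hε => fatou_ev.2 ?_⟩
    obtain ⟨r, hr, h⟩ := hlim ε hε
    refine ⟨r, hr, fun z h1 h2 => ?_⟩
    rw [Real.dist_eq, abs_lt]
    constructor <;> linarith [h z h1 h2]
  obtain ⟨r₀, hr₀, h₀⟩ := hlim (1/2) (by norm_num)
  obtain ⟨r, hr, h, hr0⟩ : ∃ r : ℝ, r < 1 ∧ (∀ z : ℂ, r < ‖z‖ → ‖z‖ < 1 → 0 < ‖f z‖) ∧ 0 ≤ r :=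
    ⟨max r₀ 0, max_lt hr₀ one_pos, fun z h1 h2 => by
      linarith [(h₀ z ((le_max_left _ _).trans_lt h1) h2).1], le_max_right _ _⟩
  obtain ⟨s, hs1, hs2⟩ := exists_between hr
  have hs : ‖(s:ℂ)‖ = s := by
    rw [Complex.norm_real, Real.norm_of_nonneg (hr0.trans hs1.le)]
  have hz₀ : ‖(s:ℂ)‖ < 1 := by rw [hs]; exact hs2
  have hfz : 0 < ‖f s‖ := h s (by rw [hs]; exact hs1) hz₀
  have hA : 0 < (1 - r ^ 2) * (1 - s ^ 2) := mul_pos (by nlinarith) (by nlinarith)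
  have hA1 : (1 - r ^ 2) * (1 - s ^ 2) ≤ 1 :=
    mul_le_one₀ (by nlinarith) (by nlinarith) (by nlinarith)
  have hρlt : Real.sqrt (1 - (1 - r ^ 2) * (1 - s ^ 2) / 4) < 1 := by
    rw [Real.sqrt_lt' one_pos]
    linarith
  obtain ⟨n, hn⟩ := exists_pow_lt_of_lt_one hfz hρlt
  refine fatou_induct (r := r) hz₀ (Real.sqrt_pos.2 (by linarith)) ?_ n f hP ?_ hn
  · intro a ha har
    apply Real.le_sqrt_of_sq_le
    rw [fatou_bsq ha hz₀, hs]
    have hd0 : 0 < ‖1 - (starRingEnd ℂ) a * (s:ℂ)‖ := by linarith [fatou_den ha hz₀]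
    have hd : ‖1 - (starRingEnd ℂ) a * (s:ℂ)‖ ≤ 2 := by
      have h := norm_sub_le (1:ℂ) ((starRingEnd ℂ) a * (s:ℂ))
      rw [norm_mul, RCLike.norm_conj, norm_one] at h
      nlinarith [norm_nonneg a, norm_nonneg (s:ℂ)]
    have hd4 : ‖1 - (starRingEnd ℂ) a * (s:ℂ)‖ ^ 2 ≤ 4 := by nlinarith
    have hsp : 0 ≤ 1 - s ^ 2 := by nlinarith
    have hap : 0 ≤ 1 - ‖a‖ ^ 2 := by nlinarith [norm_nonneg a]
    gcongr
  · intro z hz hfz0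
    by_contra hcon
    have := h z (not_le.1 hcon) hz
    rw [hfz0, norm_zero] at this
    exact lt_irrefl _ this
end

section
/- The set of finite Blaschke products is closed in the supremum norm: if (B_n) is a sequence of finite Blaschke products on 𝔻 and f : 𝔻 → ℂ is a function such that sup_{z ∈ 𝔻} |B_n(z) − f(z)| → 0, then f is a finite Blaschke product. -/
open Complex Metric Set Filter

lemma blaschke_den_ne {a z : ℂ} (h : ‖a‖ * ‖z‖ < 1) : 1 - (starRingEnd ℂ) a * z ≠ 0 := by
  intro h0
  have h1 : (starRingEnd ℂ) a * z = 1 := (sub_eq_zero.mp h0).symm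
  have h2 : ‖(starRingEnd ℂ) a * z‖ = 1 := by rw [h1]; simp
  rw [norm_mul, RCLike.norm_conj] at h2
  linarith

lemma blaschke_factor_norm {a z : ℂ} (ha : ‖a‖ < 1) (hz : ‖z‖ = 1) :
    ‖(a - z) / (1 - (starRingEnd ℂ) a * z)‖ = 1 := by
  have hne : 1 - (starRingEnd ℂ) a * z ≠ 0 := blaschke_den_ne (by rw [hz]; linarith)
  have hzz : (starRingEnd ℂ) z * z = 1 := by
    rw [mul_comm, Complex.mul_conj, Complex.normSq_eq_norm_sq, hz]; simp
  have h : ‖1 - (starRingEnd ℂ) a * z‖ = ‖a - z‖ := by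
    have : 1 - (starRingEnd ℂ) a * z = (starRingEnd ℂ) (z - a) * z := by
      rw [map_sub, sub_mul, hzz]
    rw [this, norm_mul, RCLike.norm_conj, hz, mul_one, norm_sub_rev]
  rw [norm_div, ← h, div_self (norm_ne_zero_iff.mpr hne)]

lemma finBlaschke_norm {n : ℕ} {c : ℂ} {a : Fin n → ℂ} (hc : ‖c‖ = 1) (ha : ∀ k, ‖a k‖ < 1)
    {z : ℂ} (hz : ‖z‖ = 1) : ‖finBlaschke n c a z‖ = 1 := by
  unfold finBlaschke
  rw [norm_mul, hc, one_mul, norm_prod]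
  exact Finset.prod_eq_one fun k _ => blaschke_factor_norm (ha k) hz

lemma finBlaschke_diff {n : ℕ} {c : ℂ} {a : Fin n → ℂ} (ha : ∀ k, ‖a k‖ < 1)
    {z : ℂ} (hz : ‖z‖ ≤ 1) : DifferentiableAt ℂ (finBlaschke n c a) z := by
  unfold finBlaschke
  refine DifferentiableAt.const_mul ?_ c
  refine DifferentiableAt.fun_finsetProd fun k _ => ?_
  refine DifferentiableAt.div (by fun_prop) (by fun_prop) (blaschke_den_ne ?_)
  nlinarith [ha k, norm_nonneg (a k), norm_nonneg z]

/-- logarithmic derivative of one factor -/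
noncomputable def facLog (a z : ℂ) : ℂ :=
  (z - a)⁻¹ + (starRingEnd ℂ) a / (1 - (starRingEnd ℂ) a * z)

lemma facLog_eq {a z : ℂ} (ha : ‖a‖ < 1) (hz : ‖z‖ = 1) :
    logDeriv (fun z => (a - z) / (1 - (starRingEnd ℂ) a * z)) z = facLog a z := by
  have hne : 1 - (starRingEnd ℂ) a * z ≠ 0 := blaschke_den_ne (by rw [hz]; linarith)
  have haz : a - z ≠ 0 := by
    intro h
    rw [sub_eq_zero.mp h] at ha
    linarith
  have haz' : z - a ≠ 0 := by rw [← neg_sub]; exact neg_ne_zero.mpr haz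
  have h1 : HasDerivAt (fun z => a - z) (-1) z := by
    simpa using (hasDerivAt_id z).const_sub a
  have h2 : HasDerivAt (fun z => 1 - (starRingEnd ℂ) a * z) (-(starRingEnd ℂ) a) z := by
    simpa using ((hasDerivAt_id z).const_mul ((starRingEnd ℂ) a)).const_sub 1
  rw [logDeriv_div _ haz hne h1.differentiableAt h2.differentiableAt, logDeriv_apply,
    logDeriv_apply, h1.deriv, h2.deriv, facLog]
  rw [← neg_sub z a, neg_div_neg_eq, one_div, neg_div, sub_neg_eq_add]

lemma finBlaschke_logDeriv {n : ℕ} {c : ℂ} {a : Fin n → ℂ} (hc : ‖c‖ = 1) (ha : ∀ k, ‖a k‖ < 1)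
    {z : ℂ} (hz : ‖z‖ = 1) : logDeriv (finBlaschke n c a) z = ∑ k, facLog (a k) z := by
  have hc0 : c ≠ 0 := by rintro rfl; simp at hc
  unfold finBlaschke
  rw [logDeriv_const_mul _ _ hc0, logDeriv_prod]
  · exact Finset.sum_congr rfl fun k _ => facLog_eq (ha k) hz
  · intro k _ h0
    have := blaschke_factor_norm (ha k) hz
    rw [h0] at this
    simp at this
  · intro k _
    refine DifferentiableAt.div (by fun_prop) (by fun_prop) (blaschke_den_ne ?_)
    rw [hz]; linarith [ha k]

lemma facLog_parts {a : ℂ} (ha : ‖a‖ < 1) :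
    CircleIntegrable (facLog a) 0 1 ∧ (∮ z in C(0, 1), facLog a z) = 2 * Real.pi * I := by
  have hd : DifferentiableOn ℂ (fun z => (starRingEnd ℂ) a / (1 - (starRingEnd ℂ) a * z))
      (closedBall 0 1) := by
    intro z hz
    have hz : ‖z‖ ≤ 1 := by simpa using hz
    refine DifferentiableAt.differentiableWithinAt ?_
    refine DifferentiableAt.div (by fun_prop) (by fun_prop) (blaschke_den_ne ?_)
    nlinarith [norm_nonneg a, norm_nonneg z]
  have i1 : CircleIntegrable (fun z => (z - a)⁻¹) 0 1 := by
    rw [circleIntegrable_sub_inv_iff]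
    right
    simp only [abs_one, mem_sphere_iff_norm, sub_zero]
    exact ha.ne
  have i2 : CircleIntegrable (fun z => (starRingEnd ℂ) a / (1 - (starRingEnd ℂ) a * z)) 0 1 :=
    (hd.continuousOn.mono sphere_subset_closedBall).circleIntegrable zero_le_one
  refine ⟨i1.add i2, ?_⟩
  unfold facLog
  rw [circleIntegral.integral_add i1 i2,
    circleIntegral.integral_sub_inv_of_mem_ball (by simpa using ha)]
  rw [(hd.diffContOnCl_ball subset_rfl).circleIntegral_eq_zero zero_le_one, add_zero]

lemma sum_integral {n : ℕ} {a : Fin n → ℂ} (ha : ∀ k, ‖a k‖ < 1) :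
    CircleIntegrable (fun z => ∑ k, facLog (a k) z) 0 1 ∧
    (∮ z in C(0, 1), ∑ k, facLog (a k) z) = n * (2 * Real.pi * I) := by
  refine ⟨CircleIntegrable.fun_sum _ fun k _ => (facLog_parts (ha k)).1, ?_⟩
  rw [circleIntegral.integral_fun_sum fun k _ => (facLog_parts (ha k)).1]
  simp [(facLog_parts (ha _)).2]

lemma degree_eq {n m : ℕ} {c d : ℂ} {a : Fin n → ℂ} {b : Fin m → ℂ} (hc : ‖c‖ = 1)
    (hd : ‖d‖ = 1) (ha : ∀ k, ‖a k‖ < 1) (hb : ∀ k, ‖b k‖ < 1)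
    (h : ∀ z ∈ ball (0:ℂ) 1, ‖finBlaschke n c a z - finBlaschke m d b z‖ ≤ 1 / 2) : n = m := by
  have hcl : ∀ z ∈ closedBall (0:ℂ) 1, ‖finBlaschke n c a z - finBlaschke m d b z‖ ≤ 1 / 2 := by
    intro z hz
    rw [← closure_ball (0:ℂ) one_ne_zero] at hz
    refine le_on_closure h ?_ continuousOn_const hz
    rw [closure_ball (0:ℂ) one_ne_zero]
    intro w hw
    have hw : ‖w‖ ≤ 1 := by simpa using hw
    exact ((finBlaschke_diff ha hw).continuousAt.sub
      (finBlaschke_diff hb hw).continuousAt).norm.continuousWithinAt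
  have key : (∮ z in C(0, 1), (∑ k, facLog (a k) z - ∑ k, facLog (b k) z)) = 0 := by
    apply circleIntegral.integral_eq_zero_of_hasDerivWithinAt
      (f := fun z => Complex.log (finBlaschke n c a z / finBlaschke m d b z)) zero_le_one
    intro z hz
    have hz1 : ‖z‖ = 1 := by simpa using hz
    have hA := finBlaschke_norm hc ha hz1
    have hB := finBlaschke_norm hd hb hz1
    have hA0 : finBlaschke n c a z ≠ 0 := by intro h0; simp [h0] at hA
    have hB0 : finBlaschke m d b z ≠ 0 := by intro h0; simp [h0] at hB
    have dA := finBlaschke_diff (c := c) ha hz1.le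
    have dB := finBlaschke_diff (c := d) hb hz1.le
    have hs : finBlaschke n c a z / finBlaschke m d b z ∈ slitPlane := by
      have : finBlaschke n c a z / finBlaschke m d b z =
        1 + (finBlaschke n c a z - finBlaschke m d b z) / finBlaschke m d b z := by
        field_simp; ring
      rw [this]
      apply Complex.mem_slitPlane_of_norm_lt_one
      rw [norm_div, hB, div_one]
      exact (hcl z (sphere_subset_closedBall hz)).trans_lt (by norm_num)
    have := (dA.div dB hB0).hasDerivAt.clog hs
    rw [← finBlaschke_logDeriv hc ha hz1, ← finBlaschke_logDeriv hd hb hz1,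
      ← logDeriv_div z hA0 hB0 dA dB, logDeriv_apply]
    exact this.hasDerivWithinAt
  rw [circleIntegral.integral_sub (sum_integral ha).1 (sum_integral hb).1, (sum_integral ha).2,
    (sum_integral hb).2, sub_eq_zero] at key
  exact_mod_cast mul_right_cancel₀ Complex.two_pi_I_ne_zero key

lemma closed_params (n : ℕ) : ∀ (c : ℂ) (a : Fin n → ℂ), ‖c‖ = 1 → (∀ k, ‖a k‖ ≤ 1) →
    IsFiniteBlaschkeOn (finBlaschke n c a) (ball (0:ℂ) 1) := by
  induction n with
  | zero => exact fun c a hc ha => ⟨0, c, a, hc, fun k => k.elim0, fun z _ => rfl⟩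
  | succ n ih =>
    intro c a hc ha
    have hsplit : ∀ z, finBlaschke (n + 1) c a z =
        (a 0 - z) / (1 - (starRingEnd ℂ) (a 0) * z) * finBlaschke n c (fun k => a k.succ) z := by
      intro z
      simp only [finBlaschke, Fin.prod_univ_succ]
      ring
    obtain ⟨m, c', b, hc', hb, he⟩ := ih c (fun k => a k.succ) hc fun k => ha _
    rcases (ha 0).lt_or_eq with h | h
    · refine ⟨m + 1, c', Fin.cons (a 0) b, hc', ?_, ?_⟩
      · intro k
        refine Fin.cases ?_ (fun i => ?_) k
        · simpa using h
        · simpa using hb i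
      · intro z hz
        rw [hsplit, he hz]
        simp only [finBlaschke, Fin.prod_univ_succ, Fin.cons_zero, Fin.cons_succ]
        ring
    · refine ⟨m, a 0 * c', b, by rw [norm_mul, h, hc', one_mul], hb, ?_⟩
      intro z hz
      have hz : ‖z‖ < 1 := by simpa using hz
      have hne : 1 - (starRingEnd ℂ) (a 0) * z ≠ 0 := blaschke_den_ne (by rw [h]; linarith)
      have haa : a 0 * (starRingEnd ℂ) (a 0) = 1 := by
        rw [Complex.mul_conj, Complex.normSq_eq_norm_sq, h]; simp
      have hf : (a 0 - z) / (1 - (starRingEnd ℂ) (a 0) * z) = a 0 := by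
        rw [div_eq_iff hne]
        linear_combination z * haa
      rw [hsplit, he (by simpa using hz), hf]
      simp only [finBlaschke]
      ring

/-- The set of finite Blaschke products is closed in the supremum norm: a uniform limit on the
open unit disc of finite Blaschke products is a finite Blaschke product. -/
theorem finite_blaschke_closed (B : ℕ → ℂ → ℂ) (f : ℂ → ℂ)
    (hB : ∀ n, IsFiniteBlaschkeOn (B n) (ball (0:ℂ) 1))
    (hconv : TendstoUniformlyOn B f atTop (ball (0:ℂ) 1)) :
    IsFiniteBlaschkeOn f (ball (0:ℂ) 1) := by
  obtain ⟨N, hN⟩ := eventually_atTop.mp (Metric.tendstoUniformlyOn_iff.mp hconv (1 / 4) (by norm_num))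
  obtain ⟨d, c0, a0, hc0, ha0, he0⟩ := hB N
  have hdeg : ∀ n, ∃ p : ℂ × (Fin d → ℂ), ‖p.1‖ = 1 ∧ (∀ k, ‖p.2 k‖ < 1) ∧
      Set.EqOn (B (n + N)) (finBlaschke d p.1 p.2) (ball (0:ℂ) 1) := by
    intro n
    obtain ⟨m, c, a, hc, ha, he⟩ := hB (n + N)
    have : m = d := by
      refine degree_eq hc hc0 ha ha0 fun z hz => ?_
      rw [← he hz, ← he0 hz, ← dist_eq_norm]
      have h1 := hN (n + N) (by omega) z hz
      have h2 := hN N le_rfl z hz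
      have h3 := dist_triangle_left (B (n + N) z) (B N z) (f z)
      linarith
    subst this
    exact ⟨(c, a), hc, ha, he⟩
  choose p hp1 hp2 hp3 using hdeg
  have hK : IsCompact ((sphere (0:ℂ) 1) ×ˢ (Set.pi univ fun _ : Fin d => closedBall (0:ℂ) 1)) :=
    (isCompact_sphere _ _).prod (isCompact_univ_pi fun _ => isCompact_closedBall _ _)
  obtain ⟨q, hq, φ, hφ, hlim⟩ := hK.tendsto_subseq (x := p) (fun n => by
    refine ⟨by simpa using hp1 n, fun k _ => by simpa using (hp2 n k).le⟩)
  have hq1 : ‖q.1‖ = 1 := by simpa using hq.1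
  have hq2 : ∀ k, ‖q.2 k‖ ≤ 1 := fun k => by simpa using hq.2 k (mem_univ k)
  obtain ⟨m, c, a, hc, ha, he⟩ := closed_params d q.1 q.2 hq1 hq2
  refine ⟨m, c, a, hc, ha, fun z hz => ?_⟩
  rw [← he hz]
  have hz1 : ‖z‖ < 1 := by simpa using hz
  have t1 : Tendsto (fun n => B (φ n + N) z) atTop (nhds (f z)) :=
    (hconv.tendsto_at hz).comp ((tendsto_add_atTop_nat N).comp hφ.tendsto_atTop)
  have hcont : ContinuousAt (fun r : ℂ × (Fin d → ℂ) => finBlaschke d r.1 r.2 z) q := by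
    unfold finBlaschke
    refine ContinuousAt.mul (by fun_prop) (tendsto_finsetProd _ fun k _ => ?_)
    refine ContinuousAt.div (by fun_prop) ?_ (blaschke_den_ne ?_)
    · exact (continuous_const.sub ((Complex.continuous_conj.comp
        ((continuous_apply k).comp continuous_snd)).mul continuous_const)).continuousAt
    · nlinarith [hq2 k, norm_nonneg (q.2 k), norm_nonneg z]
  have t2 : Tendsto (fun n => finBlaschke d (p (φ n)).1 (p (φ n)).2 z) atTop
      (nhds (finBlaschke d q.1 q.2 z)) := hcont.tendsto.comp hlim
  refine tendsto_nhds_unique t1 (t2.congr fun n => ?_)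
  exact (hp3 (φ n) hz).symm
end

section
/- Let f ∈ L^∞(𝕋). Then the distance from f to H^∞(𝕋) is attained: there exists g ∈ H^∞(𝕋) such that dist(f, H^∞(𝕋)) = ‖f − g‖_∞. -/
open Complex MeasureTheory AddCircle
open scoped Real

instance : Fact (0 < 2 * Real.pi) := ⟨by positivity⟩

/-- `H^∞(𝕋)`: the elements of `L^∞` of the circle whose negative Fourier coefficients all
vanish. -/
noncomputable def Hinf : Set (Lp ℂ ⊤ (haarAddCircle : Measure (AddCircle (2*π)))) :=
  {g | ∀ n : ℤ, n < 0 → fourierCoeff (⇑g) n = 0}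


/-- Nested bounded closed midpoint-convex nonempty sets in a Hilbert space intersect. -/
theorem nested_inter_nonempty {E : Type*} [NormedAddCommGroup E] [InnerProductSpace ℂ E]
    [CompleteSpace E] (K : ℕ → Set E) (hanti : Antitone K) (hne : ∀ n, (K n).Nonempty)
    (hcl : ∀ n, IsClosed (K n))
    (hmid : ∀ n, ∀ x ∈ K n, ∀ y ∈ K n, (1 / 2 : ℂ) • (x + y) ∈ K n)
    (B : ℝ) (hB : ∀ x ∈ K 0, ‖x‖ ≤ B) : ∃ x, ∀ n, x ∈ K n := by
  set s : ℕ → ℝ := fun n => sInf ((fun x : E => ‖x‖ ^ 2) '' K n) with hs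
  have hbdd : ∀ n, BddBelow ((fun x : E => ‖x‖ ^ 2) '' K n) := fun n =>
    ⟨0, by rintro _ ⟨x, _, rfl⟩; positivity⟩
  have hsle : ∀ n, ∀ x ∈ K n, s n ≤ ‖x‖ ^ 2 := fun n x hx =>
    csInf_le (hbdd n) ⟨x, hx, rfl⟩
  have hmono : Monotone s := fun m n hmn =>
    csInf_le_csInf (hbdd m) ((hne n).image _) (Set.image_mono (hanti hmn))
  have hsB : ∀ n, s n ≤ B ^ 2 := by
    intro n
    obtain ⟨x, hx⟩ := hne n
    have h1 := hB x (hanti (Nat.zero_le n) hx)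
    have h2 := hsle n x hx
    have h3 := norm_nonneg x
    nlinarith
  have hbA : BddAbove (Set.range s) := ⟨B ^ 2, by rintro _ ⟨n, rfl⟩; exact hsB n⟩
  set S : ℝ := ⨆ n, s n with hS
  have hlim : Filter.Tendsto s Filter.atTop (nhds S) := tendsto_atTop_ciSup hmono hbA
  have hleS : ∀ n, s n ≤ S := fun n => le_ciSup hbA n
  have hex : ∀ n : ℕ, ∃ x ∈ K n, ‖x‖ ^ 2 < s n + 1 / ((n : ℝ) + 1) := by
    intro n
    have hlt : s n < s n + 1 / ((n : ℝ) + 1) := by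
      have : (0 : ℝ) < 1 / ((n : ℝ) + 1) := by positivity
      linarith
    obtain ⟨_, ⟨x, hx, rfl⟩, h⟩ := exists_lt_of_csInf_lt ((hne n).image _) hlt
    exact ⟨x, hx, h⟩
  choose x hxK hx using hex
  have hcau : CauchySeq x := by
    refine cauchySeq_of_le_tendsto_0
      (fun N : ℕ => Real.sqrt (4 * (S - s N) + 4 * (1 / ((N : ℝ) + 1)))) ?_ ?_
    · intro n m N hn hm
      rw [dist_eq_norm]
      apply Real.le_sqrt_of_sq_le
      have hxn := hx n
      have hxm := hx m
      have en : 1 / ((n : ℝ) + 1) ≤ 1 / ((N : ℝ) + 1) := by gcongr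
      have em : 1 / ((m : ℝ) + 1) ≤ 1 / ((N : ℝ) + 1) := by gcongr
      have hmidp := hsle N _ (hmid N _ (hanti hn (hxK n)) _ (hanti hm (hxK m)))
      rw [norm_smul] at hmidp
      have hhalf : ‖(1 / 2 : ℂ)‖ = 1 / 2 := by norm_num
      rw [hhalf] at hmidp
      have hpar := parallelogram_law_with_norm ℂ (x n) (x m)
      have := hleS n
      have := hleS m
      nlinarith
    · have h1 : Filter.Tendsto (fun N : ℕ => 4 * (S - s N) + 4 * (1 / ((N : ℝ) + 1)))
          Filter.atTop (nhds (4 * (S - S) + 4 * 0)) :=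
        ((tendsto_const_nhds.sub hlim).const_mul 4).add
          (tendsto_one_div_add_atTop_nhds_zero_nat.const_mul 4)
      have h2 := h1.sqrt
      simpa using h2
  obtain ⟨y, hy⟩ := cauchySeq_tendsto_of_complete hcau
  refine ⟨y, fun n => (hcl n).mem_of_tendsto hy ?_⟩
  filter_upwards [Filter.eventually_ge_atTop n] with m hm
  exact hanti hm (hxK m)

theorem fourierCoeff_congr_ae' {u v : AddCircle (2*π) → ℂ}
    (h : u =ᵐ[haarAddCircle] v) (n : ℤ) : fourierCoeff u n = fourierCoeff v n := by
  unfold fourierCoeff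
  apply integral_congr_ae
  filter_upwards [h] with t ht
  rw [ht]

theorem ae_norm_le_top (f : Lp ℂ ⊤ (haarAddCircle : Measure (AddCircle (2*π)))) :
    ∀ᵐ x ∂(haarAddCircle : Measure (AddCircle (2*π))), ‖f x‖ ≤ ‖f‖ := by
  have h := ae_le_lpNorm_exponent_top (Lp.memLp f)
  rwa [← toReal_eLpNorm (Lp.memLp f).aestronglyMeasurable, ← Lp.norm_def] at h

/-- Square-integrable competitors. -/
def compSet (f : Lp ℂ ⊤ (haarAddCircle : Measure (AddCircle (2*π)))) (r : ℝ) :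
    Set (Lp ℂ 2 (haarAddCircle : Measure (AddCircle (2*π)))) :=
  {h | (∀ᵐ x ∂(haarAddCircle : Measure (AddCircle (2*π))), ‖f x - h x‖ ≤ r) ∧
    ∀ n : ℤ, n < 0 → fourierBasis.repr h n = 0}

theorem compSet_closed (f : Lp ℂ ⊤ (haarAddCircle : Measure (AddCircle (2*π)))) (r : ℝ) :
    IsClosed (compSet f r) := by
  apply IsSeqClosed.isClosed
  intro u h hu hlim
  refine ⟨?_, ?_⟩
  · obtain ⟨ns, -, hns⟩ := (tendstoInMeasure_of_tendsto_Lp hlim).exists_seq_tendsto_ae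
    have hall : ∀ᵐ x ∂(haarAddCircle : Measure (AddCircle (2*π))), ∀ i, ‖f x - u i x‖ ≤ r :=
      ae_all_iff.2 fun i => (hu i).1
    filter_upwards [hns, hall] with x h1 h2
    exact le_of_tendsto' (tendsto_const_nhds.sub h1).norm fun i => h2 _
  · intro n hn
    have h0 : ∀ i, inner ℂ (fourierBasis n) (u i) = 0 := fun i => by
      rw [← HilbertBasis.repr_apply_apply]; exact (hu i).2 n hn
    rw [HilbertBasis.repr_apply_apply]
    have ht : Filter.Tendsto (fun i => inner ℂ (fourierBasis n) (u i)) Filter.atTop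
      (nhds (inner ℂ (fourierBasis n) h)) := tendsto_const_nhds.inner hlim
    simp only [h0] at ht
    exact tendsto_nhds_unique ht tendsto_const_nhds

theorem compSet_mid (f : Lp ℂ ⊤ (haarAddCircle : Measure (AddCircle (2*π)))) (r : ℝ) :
    ∀ x ∈ compSet f r, ∀ y ∈ compSet f r, (1 / 2 : ℂ) • (x + y) ∈ compSet f r := by
  intro u hu v hv
  refine ⟨?_, ?_⟩
  · filter_upwards [hu.1, hv.1, Lp.coeFn_smul (1 / 2 : ℂ) (u + v), Lp.coeFn_add u v]
      with x h1 h2 h3 h4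
    rw [h3, Pi.smul_apply, h4, Pi.add_apply, smul_eq_mul]
    have e : f x - 1 / 2 * (u x + v x) = (1 / 2 : ℂ) * ((f x - u x) + (f x - v x)) := by ring
    rw [e, norm_mul]
    have hhalf : ‖(1 / 2 : ℂ)‖ = 1 / 2 := by norm_num
    rw [hhalf]
    have := norm_add_le (f x - u x) (f x - v x)
    linarith
  · intro n hn
    have h1 := hu.2 n hn
    have h2 := hv.2 n hn
    rw [HilbertBasis.repr_apply_apply] at h1 h2 ⊢
    rw [inner_smul_right, inner_add_right, h1, h2]
    simp

theorem compSet_bound (f : Lp ℂ ⊤ (haarAddCircle : Measure (AddCircle (2*π)))) (r : ℝ)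
    (h : Lp ℂ 2 (haarAddCircle : Measure (AddCircle (2*π)))) (hh : h ∈ compSet f r) :
    ∀ᵐ x ∂(haarAddCircle : Measure (AddCircle (2*π))), ‖h x‖ ≤ ‖f‖ + r := by
  filter_upwards [hh.1, ae_norm_le_top f] with x h1 h2
  have := norm_sub_le (f x) (f x - h x)
  rw [sub_sub_cancel] at this
  linarith

/-- The distance from an element of `L^∞(𝕋)` to `H^∞(𝕋)` is attained. -/
theorem dist_to_Hinf_attained (f : Lp ℂ ⊤ (haarAddCircle : Measure (AddCircle (2*π)))) :
    ∃ g ∈ Hinf, Metric.infDist f Hinf = ‖f - g‖ := by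
  have hHne : Hinf.Nonempty := by
    refine ⟨0, fun n _ => ?_⟩
    rw [fourierCoeff_congr_ae' (Lp.coeFn_zero ℂ ⊤ _) n]
    simp [fourierCoeff]
  set d := Metric.infDist f Hinf with hd
  have hd0 : 0 ≤ d := Metric.infDist_nonneg
  have hpos : ∀ n : ℕ, (0 : ℝ) < 1 / ((n : ℝ) + 1) := fun n => by positivity
  obtain ⟨h, hh⟩ := nested_inter_nonempty (fun n : ℕ => compSet f (d + 1 / ((n : ℝ) + 1)))
    (by
      intro m n hmn h hh
      refine ⟨?_, hh.2⟩
      have e : 1 / ((n : ℝ) + 1) ≤ 1 / ((m : ℝ) + 1) := by gcongr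
      filter_upwards [hh.1] with x hx
      linarith)
    (by
      intro n
      obtain ⟨g, hg, hlt⟩ := (Metric.infDist_lt_iff hHne).1
        (show Metric.infDist f Hinf < d + 1 / ((n : ℝ) + 1) by linarith [hpos n])
      have hg2 : MemLp g 2 (haarAddCircle : Measure (AddCircle (2*π))) :=
        (Lp.memLp g).mono_exponent le_top
      refine ⟨hg2.toLp g, ?_, ?_⟩
      · filter_upwards [hg2.coeFn_toLp, ae_norm_le_top (f - g), Lp.coeFn_sub f g] with x h1 h2 h3
        rw [h1]
        rw [h3, Pi.sub_apply] at h2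
        rw [dist_eq_norm] at hlt
        linarith
      · intro k hk
        rw [fourierBasis_repr, fourierCoeff_congr_ae' hg2.coeFn_toLp]
        exact hg k hk)
    (fun n => compSet_closed f _) (fun n => compSet_mid f _)
    (measureUnivNNReal (haarAddCircle : Measure (AddCircle (2*π))) ^ (2 : ENNReal).toReal⁻¹ *
      (‖f‖ + (d + 1 / (((0 : ℕ) : ℝ) + 1))))
    (by
      intro h hh
      exact Lp.norm_le_of_ae_bound (by have := hpos 0; positivity) (compSet_bound f _ h hh))
  have hbd : ∀ᵐ x ∂(haarAddCircle : Measure (AddCircle (2*π))), ‖f x - h x‖ ≤ d := by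
    have hall : ∀ᵐ x ∂(haarAddCircle : Measure (AddCircle (2*π))),
        ∀ n : ℕ, ‖f x - h x‖ ≤ d + 1 / ((n : ℝ) + 1) := ae_all_iff.2 fun n => (hh n).1
    filter_upwards [hall] with x hx
    have ht := (tendsto_one_div_add_atTop_nhds_zero_nat (𝕜 := ℝ)).const_add d
    rw [add_zero] at ht
    exact ge_of_tendsto' ht hx
  have hT : MemLp h ⊤ (haarAddCircle : Measure (AddCircle (2*π))) :=
    memLp_top_of_bound (Lp.aestronglyMeasurable h) _ (compSet_bound f _ h (hh 0))
  have hmem : hT.toLp h ∈ Hinf := by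
    intro k hk
    rw [fourierCoeff_congr_ae' hT.coeFn_toLp, ← fourierBasis_repr]
    exact (hh 0).2 k hk
  refine ⟨hT.toLp h, hmem, le_antisymm ?_ ?_⟩
  · rw [← dist_eq_norm]
    exact Metric.infDist_le_dist_of_mem hmem
  · have hb : ∀ᵐ x ∂(haarAddCircle : Measure (AddCircle (2*π))), ‖(f - hT.toLp h) x‖ ≤ d := by
      filter_upwards [hbd, hT.coeFn_toLp, Lp.coeFn_sub f (hT.toLp h)] with x h1 h2 h3
      rw [h3, Pi.sub_apply, h2]
      exact h1
    simpa using Lp.norm_le_of_ae_bound hd0 hb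
end
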